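/- Let n ≥ 1 and 0 < s < 1 with n > 2s, and let R, M > 0. Let h : ℝⁿ×ℝ → ℝ be measurable with 0 ≤ h ≤ M and h(y,τ) = 0 whenever |y| > R or |τ| > R². Define v(x,t) = ∫_ℝ ∫_{ℝⁿ} G(x−y, t−τ) h(y,τ) dy dτ. Then v is finite everywhere and v(x,t) → 0 as |x| → ∞ uniformly in t; that is, for every ε > 0 there exists K > 0 such that v(x,t) ≤ ε for all t ∈ ℝ whenever |x| ≥ K. -/

import Mathlib

open MeasureTheory

/-- `ℝⁿ` as Euclidean space. -/
abbrev En (n : ℕ) := EuclideanSpace ℝ (Fin n)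

/-- The fundamental solution `G(x,t) = A_{n,s} t^{-(n/2+1-s)} e^{-|x|²/(4t)}` for `t > 0`,
`G(x,t) = 0` for `t ≤ 0`, with `A_{n,s} = (4π)^{-n/2}/Γ(s)`. -/
noncomputable def Gker (n : ℕ) (s : ℝ) (x : En n) (t : ℝ) : ℝ :=
  if 0 < t then
    ((4 * Real.pi) ^ (-(n : ℝ) / 2) / Real.Gamma s) *
      (t ^ (-((n : ℝ) / 2 + 1 - s)) * Real.exp (-‖x‖ ^ 2 / (4 * t)))
  else 0

lemma Gker_nonneg (n : ℕ) {s : ℝ} (hs : 0 < s) (x : En n) (t : ℝ) : 0 ≤ Gker n s x t := by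
  unfold Gker
  have := Real.Gamma_pos_of_pos hs
  split_ifs <;> positivity

lemma measurable_Gker (n : ℕ) (s : ℝ) :
    Measurable (fun q : En n × ℝ => Gker n s q.1 q.2) := by
  unfold Gker
  refine Measurable.ite (measurableSet_lt measurable_const measurable_snd) ?_ measurable_const
  fun_prop

lemma integral_exp_neg_norm_sq_div (n : ℕ) {t : ℝ} (ht : 0 < t) :
    ∫ x : En n, Real.exp (-‖x‖ ^ 2 / (4 * t)) = (4 * Real.pi * t) ^ ((n : ℝ) / 2) := by
  have h := GaussianFourier.integral_rexp_neg_mul_sq_norm (V := En n)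
    (b := 1 / (4 * t)) (by positivity)
  rw [finrank_euclideanSpace_fin] at h
  convert h using 2
  · ext x
    ring_nf
  · field_simp

lemma integrable_exp_neg_norm_sq_div (n : ℕ) {t : ℝ} (ht : 0 < t) :
    Integrable (fun x : En n => Real.exp (-‖x‖ ^ 2 / (4 * t))) := by
  refine .of_integral_ne_zero ?_
  rw [integral_exp_neg_norm_sq_div n ht]
  positivity

lemma integrable_Gker_left (n : ℕ) (s t : ℝ) : Integrable (fun x : En n => Gker n s x t) := by
  unfold Gker
  split_ifs with ht
  · exact ((integrable_exp_neg_norm_sq_div n ht).const_mul _).const_mul _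
  · exact integrable_zero _ _ _

lemma integral_Gker (n : ℕ) (s : ℝ) {t : ℝ} (ht : 0 < t) :
    ∫ x : En n, Gker n s x t = t ^ (s - 1) / Real.Gamma s := by
  simp only [Gker, if_pos ht, integral_const_mul, integral_exp_neg_norm_sq_div n ht]
  have hpi : (0 : ℝ) < 4 * Real.pi := by positivity
  rw [Real.mul_rpow hpi.le ht.le, neg_div, Real.rpow_neg hpi.le,
    show s - 1 = -((n : ℝ) / 2 + 1 - s) + (n : ℝ) / 2 by ring, Real.rpow_add ht]
  have : (4 * Real.pi) ^ ((n : ℝ) / 2) ≠ 0 := by positivity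
  field_simp

lemma integrableOn_Gker (n : ℕ) {s : ℝ} (hs : 0 < s) (T : ℝ) :
    IntegrableOn (fun q : En n × ℝ => Gker n s q.1 q.2) (Set.univ ×ˢ Set.Iic T) := by
  rw [IntegrableOn, Measure.volume_eq_prod, ← Measure.prod_restrict, Measure.restrict_univ,
    integrable_prod_iff' (measurable_Gker n s).aestronglyMeasurable]
  refine ⟨.of_forall fun t => integrable_Gker_left n s t, ?_⟩
  have hI : (fun t => ∫ x : En n, ‖Gker n s x t‖) =
      (Set.Ioi 0).indicator (fun t => t ^ (s - 1) / Real.Gamma s) := by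
    ext t
    simp only [Real.norm_of_nonneg (Gker_nonneg n hs _ _)]
    by_cases ht : 0 < t
    · rw [integral_Gker n s ht, Set.indicator_of_mem (Set.mem_Ioi.2 ht)]
    · simp [Gker, ht]
  rw [hI, integrable_indicator_iff measurableSet_Ioi, IntegrableOn,
    Measure.restrict_restrict measurableSet_Ioi, Set.Ioi_inter_Iic]
  exact ((intervalIntegral.intervalIntegrable_rpow' (a := 0) (b := T) (by linarith)).1).div_const _

lemma rpow_neg_mul_exp_neg_div_le {p a u : ℝ} (hp : 0 < p) (ha : 0 < a) (hu : 0 < u) :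
    u ^ (-p) * Real.exp (-a / u) ≤ (p / a) ^ p := by
  have h1 : (a / u / p) ^ p ≤ Real.exp (a / u) := by
    calc (a / u / p) ^ p ≤ Real.exp (a / u / p) ^ p := by
          gcongr
          linarith [Real.add_one_le_exp (a / u / p)]
      _ = Real.exp (a / u) := by rw [← Real.exp_mul, div_mul_cancel₀ _ hp.ne']
  have h2 : u ^ (-p) = (p / a) ^ p * (a / u / p) ^ p := by
    rw [← Real.mul_rpow (by positivity) (by positivity), Real.rpow_neg hu.le,
      ← Real.inv_rpow hu.le]
    congr 1
    field_simp
  rw [h2, neg_div, Real.exp_neg, mul_assoc]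
  refine mul_le_of_le_one_right (by positivity) ?_
  rw [← div_eq_mul_inv]
  exact div_le_one_of_le₀ h1 (Real.exp_pos _).le

lemma Gker_le_of_le_norm (n : ℕ) {s ρ : ℝ} (hs0 : 0 < s) (hs1 : s < 1) (hρ : 0 < ρ)
    {x : En n} (hx : ρ ≤ ‖x‖) (t : ℝ) :
    Gker n s x t ≤ (4 * Real.pi) ^ (-(n : ℝ) / 2) / Real.Gamma s *
      (((n : ℝ) / 2 + 1 - s) / (ρ ^ 2 / 4)) ^ ((n : ℝ) / 2 + 1 - s) := by
  have hΓ := Real.Gamma_pos_of_pos hs0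
  have hp : 0 < (n : ℝ) / 2 + 1 - s := by
    have : (0 : ℝ) ≤ (n : ℝ) / 2 := by positivity
    linarith
  unfold Gker
  split_ifs with ht
  · gcongr
    refine le_trans ?_ (rpow_neg_mul_exp_neg_div_le hp (by positivity : 0 < ρ ^ 2 / 4) ht)
    have hexp : -‖x‖ ^ 2 / (4 * t) ≤ -(ρ ^ 2 / 4) / t := by
      rw [← div_div, neg_div]
      gcongr
    gcongr
  · positivity

lemma integrable_Gker_sub_mul (n : ℕ) {s R M : ℝ} (hs : 0 < s) {h : En n × ℝ → ℝ}
    (h_meas : Measurable h) (h_bdd : ∀ q, 0 ≤ h q ∧ h q ≤ M)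
    (h_supp : ∀ y τ, R ^ 2 < |τ| → h (y, τ) = 0) (x : En n) (t : ℝ) :
    Integrable (fun q : En n × ℝ => Gker n s (x - q.1) (t - q.2) * h q) := by
  have hmp : MeasurePreserving (fun q : En n × ℝ => (x - q.1, t - q.2)) :=
    (Measure.measurePreserving_sub_left volume x).prod
      (Measure.measurePreserving_sub_left volume t)
  have hdom := (hmp.integrable_comp_of_integrable
    ((integrableOn_Gker n hs (t + R ^ 2)).integrable_indicator
      (MeasurableSet.univ.prod measurableSet_Iic))).mul_const M
  refine hdom.mono' ?_ (.of_forall fun q => ?_)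
  · exact (((measurable_Gker n s).comp hmp.measurable).mul h_meas).aestronglyMeasurable
  · obtain ⟨y, τ⟩ := q
    rw [Real.norm_of_nonneg (mul_nonneg (Gker_nonneg n hs _ _) (h_bdd _).1)]
    have hM : 0 ≤ M := (h_bdd (y, τ)).1.trans (h_bdd _).2
    by_cases hτ : R ^ 2 < |τ|
    · rw [h_supp y τ hτ, mul_zero]
      exact mul_nonneg (Set.indicator_nonneg (fun _ _ => Gker_nonneg n hs _ _) _) hM
    · have hmem : (x - y, t - τ) ∈ (Set.univ : Set (En n)) ×ˢ Set.Iic (t + R ^ 2) := by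
        refine ⟨trivial, ?_⟩
        have := (abs_le.1 (not_lt.1 hτ)).1
        simp only [Set.mem_Iic]
        linarith
      rw [Function.comp_apply, Set.indicator_of_mem hmem]
      exact mul_le_mul_of_nonneg_left (h_bdd _).2 (Gker_nonneg n hs _ _)

lemma integral_integral_le_of_le {E : Type*} [MeasurableSpace E] {μ : Measure E}
    {f : E → ℝ → ℝ} {A : Set E} {I : Set ℝ} {C : ℝ} (hA : MeasurableSet A) (hAμ : μ A ≠ ⊤)
    (hI : MeasurableSet I) (hIμ : volume I ≠ ⊤) (hf0 : ∀ y τ, 0 ≤ f y τ)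
    (hfC : ∀ y ∈ A, ∀ τ ∈ I, f y τ ≤ C) (hf : ∀ y τ, y ∉ A ∨ τ ∉ I → f y τ = 0) :
    ∫ τ, ∫ y, f y τ ∂μ ≤ volume.real I * (μ.real A * C) := by
  have hinner : ∀ τ, ∫ y, f y τ ∂μ ≤ I.indicator (fun _ => μ.real A * C) τ := by
    intro τ
    by_cases hτ : τ ∈ I
    · rw [Set.indicator_of_mem hτ, ← smul_eq_mul, ← integral_indicator_const C hA]
      refine integral_mono_of_nonneg (.of_forall fun y => hf0 y τ)
        ((integrable_indicator_iff hA).2 (integrableOn_const hAμ)) (.of_forall fun y => ?_)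
      by_cases hy : y ∈ A
      · simpa [hy] using hfC y hy τ hτ
      · simp [hy, hf y τ (.inl hy)]
    · simp [hτ, fun y => hf y τ (.inr hτ)]
  rw [← smul_eq_mul (volume.real I), ← integral_indicator_const _ hI]
  exact integral_mono_of_nonneg (.of_forall fun τ => integral_nonneg fun y => hf0 y τ)
    ((integrable_indicator_iff hI).2 (integrableOn_const hIμ)) (.of_forall hinner)

lemma tendsto_div_sq_rpow_atTop {p : ℝ} (hp : 0 < p) :
    Filter.Tendsto (fun ρ : ℝ => (p / (ρ ^ 2 / 4)) ^ p) Filter.atTop (nhds 0) := by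
  have h1 : Filter.Tendsto (fun ρ : ℝ => p / (ρ ^ 2 / 4)) Filter.atTop (nhds 0) :=
    ((Filter.tendsto_pow_atTop two_ne_zero).atTop_div_const (by norm_num)).const_div_atTop p
  simpa [Real.zero_rpow hp.ne'] using h1.rpow_const (.inr hp.le)

/-- For a bounded compactly supported nonnegative `h`, the potential
`v(x,t) = ∫∫ G(x−y,t−τ) h(y,τ)` is finite everywhere and tends to `0` as `|x| → ∞`,
uniformly in `t`. -/
theorem potential_decay_in_x (n : ℕ) (hn : 1 ≤ n)
    (s : ℝ) (hs0 : 0 < s) (hs1 : s < 1) (hns : 2 * s < n)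
    (R M : ℝ) (hR : 0 < R) (hM : 0 < M)
    (h : En n × ℝ → ℝ) (h_meas : Measurable h)
    (h_bdd : ∀ q, 0 ≤ h q ∧ h q ≤ M)
    (h_supp : ∀ (y : En n) (τ : ℝ), R < ‖y‖ ∨ R ^ 2 < |τ| → h (y, τ) = 0) :
    (∀ (x : En n) (t : ℝ),
      Integrable (fun q : En n × ℝ => Gker n s (x - q.1) (t - q.2) * h q) volume) ∧
    ∀ ε > (0 : ℝ), ∃ K > (0 : ℝ), ∀ (x : En n) (t : ℝ), K ≤ ‖x‖ →
      (∫ τ : ℝ, ∫ y : En n, Gker n s (x - y) (t - τ) * h (y, τ)) ≤ ε := by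
  refine ⟨integrable_Gker_sub_mul n hs0 h_meas h_bdd fun y τ hτ => h_supp y τ (.inr hτ), ?_⟩
  intro ε hε
  set p : ℝ := (n : ℝ) / 2 + 1 - s with hp_def
  have hp : 0 < p := by linarith
  set A : ℝ := (4 * Real.pi) ^ (-(n : ℝ) / 2) / Real.Gamma s with hA_def
  set V : ℝ := volume.real (Metric.closedBall (0 : En n) R)
  set L : ℝ := volume.real (Set.Icc (-R ^ 2) (R ^ 2))
  have hlim : Filter.Tendsto
      (fun ρ : ℝ => L * (V * (A * (p / (ρ ^ 2 / 4)) ^ p * M))) Filter.atTop (nhds 0) := by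
    simpa using ((((tendsto_div_sq_rpow_atTop hp).const_mul A).mul_const M).const_mul V).const_mul L
  obtain ⟨ρ, hρε, hρ⟩ :=
    ((hlim.eventually_le_const hε).and (Filter.eventually_gt_atTop 0)).exists
  refine ⟨ρ + R, by positivity, fun x t hx => le_trans ?_ hρε⟩
  refine integral_integral_le_of_le (f := fun y τ => Gker n s (x - y) (t - τ) * h (y, τ))
    Metric.isClosed_closedBall.measurableSet measure_closedBall_lt_top.ne measurableSet_Icc
    measure_Icc_lt_top.ne (fun y τ => mul_nonneg (Gker_nonneg n hs0 _ _) (h_bdd _).1) ?_ ?_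
  · intro y hy τ _
    have hy' : ‖y‖ ≤ R := by simpa using hy
    have hxy : ρ ≤ ‖x - y‖ := by linarith [norm_sub_norm_le x y]
    have hG := Gker_le_of_le_norm n hs0 hs1 hρ hxy (t - τ)
    exact mul_le_mul hG (h_bdd _).2 (h_bdd _).1 ((Gker_nonneg n hs0 _ _).trans hG)
  · intro y τ hyτ
    rw [h_supp y τ, mul_zero]
    refine hyτ.imp (fun hy => ?_) fun hτ => ?_
    · simpa using hy
    · contrapose! hτ
      exact abs_le.1 hτ
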